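/- Let ρ be a density operator on the n-qubit Hilbert space (ℂ²)^{⊗n} with n ≥ 3. Let p_z be the probability, when measuring ρ in the computational basis Z^{⊗n}, of obtaining an outcome string a ∈ {0,1}ⁿ with 1 ≤ |a| ≤ n-1 (Hamming weight strictly between 0 and n), and let p_x be the analogous probability for measurement in the Hadamard basis X^{⊗n}. Set p̃ = (p_z + p_x)/2. Then 2·p̃·log₂(2^{n-1} - 1) + 2·h(p̃) ≥ n - 2, where h is the binary entropy. -/

import Mathlib

open scoped ComplexOrder

/-- Binary entropy with base-2 logarithm. -/
noncomputable def binEnt (y : ℝ) : ℝ :=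
  -y * Real.logb 2 y - (1 - y) * Real.logb 2 (1 - y)

/-- The Hamming weight of a bit string `a : Fin n → Fin 2`. -/
def hammingWt {n : ℕ} (a : Fin n → Fin 2) : ℕ :=
  (Finset.univ.filter fun i => a i = 1).card

open Finset Matrix

/-- If `a` and `b` behave like projections of `w` whose overlap is at most `δ` in the sense of
`hab`, then their squared norms are controlled by that of `w`. -/
lemma norm_sq_add_norm_sq_le_of_re_inner {E : Type*} [NormedAddCommGroup E]
    [InnerProductSpace ℂ E] (w a b : E) (δ : ℝ) (hδ : 0 ≤ δ)
    (ha : (inner ℂ w a).re = ‖a‖ ^ 2) (hb : (inner ℂ w b).re = ‖b‖ ^ 2)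
    (hab : 2 * (inner ℂ a b).re ≤ δ * (‖a‖ ^ 2 + ‖b‖ ^ 2)) :
    ‖a‖ ^ 2 + ‖b‖ ^ 2 ≤ (1 + δ) * ‖w‖ ^ 2 := by
  have hsum : ‖a + b‖ ^ 2 = ‖a‖ ^ 2 + 2 * (inner ℂ a b).re + ‖b‖ ^ 2 := norm_add_sq (𝕜 := ℂ) a b
  have hsub : ‖((1 + δ : ℝ) : ℂ) • w - (a + b)‖ ^ 2
      = ((1 + δ) * ‖w‖) ^ 2 - 2 * ((1 + δ) * (‖a‖ ^ 2 + ‖b‖ ^ 2)) + ‖a + b‖ ^ 2 := by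
    have h := norm_sub_sq (𝕜 := ℂ) (((1 + δ : ℝ) : ℂ) • w) (a + b)
    rw [h, norm_smul, inner_smul_left, inner_add_right, Complex.conj_ofReal, Complex.norm_real,
      Real.norm_of_nonneg (by linarith)]
    simp only [RCLike.re_to_complex, Complex.re_ofReal_mul, Complex.add_re, ha, hb]
  have h0 : 0 ≤ ‖((1 + δ : ℝ) : ℂ) • w - (a + b)‖ ^ 2 := by positivity
  have h1 : 0 ≤ (1 + δ) * ((1 + δ) * ‖w‖ ^ 2 - (‖a‖ ^ 2 + ‖b‖ ^ 2)) := by nlinarith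
  linarith [nonneg_of_mul_nonneg_right h1 (by linarith)]

/-- Landau–Pollak type uncertainty relation: for a unitary with small entries, the weights of a
vector on a small set of coordinates before and after the change of basis cannot both be large. -/
lemma sum_norm_sq_add_sum_norm_sq_vecMul_le {ι : Type*} [Fintype ι] [DecidableEq ι]
    (H : Matrix ι ι ℂ) (hH : H * Hᴴ = 1) (η : ℝ) (hη : 0 ≤ η)
    (hle : ∀ i j, ‖H i j‖ ≤ η) (S : Finset ι) (w : ι → ℂ) :
    ∑ i ∈ S, ‖w i‖ ^ 2 + ∑ i ∈ S, ‖(w ᵥ* H) i‖ ^ 2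
      ≤ (1 + #S * η) * ∑ i, ‖w i‖ ^ 2 := by
  set u := w ᵥ* H with hu
  have hH' : Hᴴ * H = 1 := mul_eq_one_comm.mp hH
  let r : (ι → ℂ) → ι → ℂ := fun v i => if i ∈ S then v i else 0
  have hr : ∀ v : ι → ℂ, r v ⬝ᵥ star v = ((∑ i ∈ S, ‖v i‖ ^ 2 : ℝ) : ℂ) := by
    intro v
    simp [r, dotProduct, ite_mul, Finset.sum_ite_mem, Complex.mul_conj, Complex.normSq_eq_norm_sq]
  have hrr : ∀ v : ι → ℂ, r v ⬝ᵥ star (r v) = r v ⬝ᵥ star v := by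
    intro v
    refine Finset.sum_congr rfl fun i _ => ?_
    by_cases h : i ∈ S <;> simp [r, h]
  let W : EuclideanSpace ℂ ι := WithLp.toLp 2 w
  let A : EuclideanSpace ℂ ι := WithLp.toLp 2 (r w)
  let B : EuclideanSpace ℂ ι := WithLp.toLp 2 (r u ᵥ* Hᴴ)
  have hA : ‖A‖ ^ 2 = ∑ i ∈ S, ‖w i‖ ^ 2 := by
    have h := inner_self_eq_norm_sq (𝕜 := ℂ) A
    rw [← h, EuclideanSpace.inner_eq_star_dotProduct]
    simp only [A, hrr, hr, RCLike.re_to_complex, Complex.ofReal_re]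
  have hB : ‖B‖ ^ 2 = ∑ i ∈ S, ‖u i‖ ^ 2 := by
    have h := inner_self_eq_norm_sq (𝕜 := ℂ) B
    rw [← h, EuclideanSpace.inner_eq_star_dotProduct]
    simp only [B, star_vecMul, conjTranspose_conjTranspose]
    rw [dotProduct_mulVec, vecMul_vecMul, hH', vecMul_one, hrr, hr, RCLike.re_to_complex,
      Complex.ofReal_re]
  have hWA : (inner ℂ W A).re = ‖A‖ ^ 2 := by
    rw [hA, EuclideanSpace.inner_eq_star_dotProduct]
    simp only [W, A, hr, Complex.ofReal_re]
  have hWB : (inner ℂ W B).re = ‖B‖ ^ 2 := by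
    rw [hB, EuclideanSpace.inner_eq_star_dotProduct]
    simp only [W, B]
    rw [← dotProduct_mulVec, ← star_vecMul, ← hu, hr, Complex.ofReal_re]
  have hW : ‖W‖ ^ 2 = ∑ i, ‖w i‖ ^ 2 := EuclideanSpace.norm_sq_eq _
  have hAB : 2 * (inner ℂ A B).re ≤ (#S * η) * (‖A‖ ^ 2 + ‖B‖ ^ 2) := by
    have h1 : ‖inner ℂ A B‖ ≤ η * ((∑ i ∈ S, ‖u i‖) * ∑ i ∈ S, ‖w i‖) := by
      have hexp : inner ℂ A B = ∑ j ∈ S, ∑ i ∈ S, u i * Hᴴ i j * star (w j) := by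
        rw [EuclideanSpace.inner_eq_star_dotProduct]
        simp only [A, B, dotProduct, vecMul, Finset.sum_mul]
        simp [r, ite_mul, Finset.sum_ite_mem, apply_ite]
      rw [hexp, Finset.sum_mul_sum, Finset.sum_comm, Finset.mul_sum]
      refine (norm_sum_le _ _).trans (Finset.sum_le_sum fun i _ => ?_)
      rw [Finset.mul_sum]
      refine (norm_sum_le _ _).trans (Finset.sum_le_sum fun j _ => ?_)
      rw [norm_mul, norm_mul, norm_star, conjTranspose_apply, norm_star]
      have := mul_le_mul_of_nonneg_right (hle j i) (by positivity : 0 ≤ ‖u i‖ * ‖w j‖)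
      linarith
    have h2 : (inner ℂ A B).re ≤ ‖inner ℂ A B‖ := Complex.re_le_norm _
    have h3 : (∑ i ∈ S, ‖w i‖) ^ 2 ≤ #S * ∑ i ∈ S, ‖w i‖ ^ 2 := sq_sum_le_card_mul_sum_sq
    have h4 : (∑ i ∈ S, ‖u i‖) ^ 2 ≤ #S * ∑ i ∈ S, ‖u i‖ ^ 2 := sq_sum_le_card_mul_sum_sq
    have h5 : 2 * ((∑ i ∈ S, ‖u i‖) * ∑ i ∈ S, ‖w i‖)
        ≤ #S * (∑ i ∈ S, ‖w i‖ ^ 2 + ∑ i ∈ S, ‖u i‖ ^ 2) := by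
      nlinarith [two_mul_le_add_sq (∑ i ∈ S, ‖u i‖) (∑ i ∈ S, ‖w i‖)]
    rw [hA, hB]
    nlinarith [mul_le_mul_of_nonneg_left h5 hη]
  have := norm_sq_add_norm_sq_le_of_re_inner W A B (#S * η) (by positivity) hWA hWB hAB
  rwa [hA, hB, hW] at this

lemma sum_neg_one_pow_dot_mul {n : ℕ} (a c : Fin n → Fin 2) :
    ∑ b : Fin n → Fin 2, (-1 : ℂ) ^ (∑ i, (a i).val * (b i).val) *
      (-1 : ℂ) ^ (∑ i, (b i).val * (c i).val) = if a = c then 2 ^ n else 0 := by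
  have h : ∀ b : Fin n → Fin 2, (-1 : ℂ) ^ (∑ i, (a i).val * (b i).val) *
      (-1 : ℂ) ^ (∑ i, (b i).val * (c i).val)
      = ∏ i, (-1 : ℂ) ^ ((a i).val * (b i).val + (b i).val * (c i).val) := by
    intro b
    rw [← pow_add, ← Finset.sum_add_distrib, Finset.prod_pow_eq_pow_sum]
  have key : ∀ x y : Fin 2, ∑ t : Fin 2, (-1 : ℂ) ^ (x.val * t.val + t.val * y.val)
      = if x = y then 2 else 0 := by
    intro x y
    fin_cases x <;> fin_cases y <;> norm_num
  simp_rw [h]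
  rw [← Fintype.prod_sum fun i (t : Fin 2) =>
    (-1 : ℂ) ^ ((a i).val * t.val + t.val * (c i).val)]
  simp_rw [key]
  split_ifs with hac
  · simp [hac]
  · obtain ⟨i, hi⟩ := Function.ne_iff.mp hac
    exact Finset.prod_eq_zero (Finset.mem_univ i) (if_neg hi)

lemma card_filter_not_hammingWt_le_two (n : ℕ) :
    #{a : Fin n → Fin 2 | ¬ (1 ≤ hammingWt a ∧ hammingWt a ≤ n - 1)} ≤ 2 := by
  refine (Finset.card_le_card (t := {fun _ => 0, fun _ => 1}) fun a ha => ?_).trans card_le_two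
  simp only [mem_filter, mem_univ, true_and] at ha
  simp only [mem_insert, mem_singleton]
  by_cases h : hammingWt a = 0
  · left
    rw [hammingWt, card_eq_zero, filter_eq_empty_iff] at h
    funext i
    have := h (mem_univ i)
    omega
  · right
    have hle : hammingWt a ≤ n := (card_filter_le _ _).trans (by simp)
    have hn : hammingWt a = #(univ : Finset (Fin n)) := by
      rw [card_univ, Fintype.card_fin]; omega
    funext i
    exact (card_filter_eq_iff.mp hn) i (mem_univ i)

lemma binEnt_eq_binEntropy_div (p : ℝ) : binEnt p = Real.binEntropy p / Real.log 2 := by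
  rw [binEnt, Real.binEntropy, Real.log_inv, Real.log_inv, Real.logb, Real.logb]
  ring

lemma binEnt_nonneg {p : ℝ} (h0 : 0 ≤ p) (h1 : p ≤ 1) : 0 ≤ binEnt p := by
  rw [binEnt_eq_binEntropy_div]
  exact div_nonneg (Real.binEntropy_nonneg h0 h1) (Real.log_nonneg one_le_two)

lemma two_mul_le_binEnt {p : ℝ} (h0 : 0 ≤ p) (h1 : p ≤ 1 / 2) : 2 * p ≤ binEnt p := by
  rw [binEnt_eq_binEntropy_div, le_div_iff₀ (Real.log_pos one_lt_two)]
  have h := Real.strictConcave_binEntropy.concaveOn.2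
    (show (2⁻¹ : ℝ) ∈ Set.Icc 0 1 by norm_num) (show (0 : ℝ) ∈ Set.Icc 0 1 by norm_num)
    (show 0 ≤ 2 * p by linarith) (show 0 ≤ 1 - 2 * p by linarith) (by ring)
  simp only [smul_eq_mul, Real.binEntropy_two_inv, Real.binEntropy_zero, mul_zero, add_zero] at h
  rwa [show 2 * p * 2⁻¹ = p by ring] at h

lemma sub_three_halves_le_logb {n : ℕ} (hn : 3 ≤ n) :
    (n : ℝ) - 3 / 2 ≤ Real.logb 2 ((2 : ℝ) ^ (n - 1) - 1) := by
  obtain ⟨k, rfl⟩ := Nat.exists_eq_add_of_le hn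
  have hk : (1 : ℝ) ≤ 2 ^ k := one_le_pow₀ one_le_two
  have he : (2 : ℝ) ^ (3 + k - 1) = 4 * 2 ^ k := by
    rw [show 3 + k - 1 = k + 2 by omega, pow_add]; ring
  rw [he]
  have h1 : (2 : ℝ) ^ (2 * k + 3) ≤ (4 * 2 ^ k - 1) ^ 2 := by
    have : (2 : ℝ) ^ (2 * k + 3) = 8 * (2 ^ k) ^ 2 := by rw [pow_add, pow_mul']; ring
    rw [this]; nlinarith
  have h2 := Real.logb_le_logb_of_le one_lt_two (by positivity) h1
  rw [Real.logb_pow, Real.logb_pow, Real.logb_self_eq_one one_lt_two] at h2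
  push_cast at h2 ⊢
  linarith

lemma two_mul_add_one_le_sqrt_two_pow {n : ℕ} (hn : 3 ≤ n) :
    2 * (2 * (n : ℝ) + 1) ≤ 5 * √(2 ^ n) := by
  have h : 4 * (2 * (n : ℝ) + 1) ^ 2 ≤ 25 * 2 ^ n := by
    induction n, hn using Nat.le_induction with
    | base => norm_num
    | succ k hk ih =>
      have : (3 : ℝ) ≤ k := by exact_mod_cast hk
      push_cast
      rw [pow_succ (2 : ℝ)]
      nlinarith
  refine le_of_sq_le_sq ?_ (by positivity)
  rw [mul_pow, mul_pow, Real.sq_sqrt (by positivity)]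
  linarith

/-- The entropic bound holds as soon as `p` is not much smaller than `1 / 2`. -/
lemma sub_two_le_of_half_sub_le {n : ℕ} (hn : 3 ≤ n) {p : ℝ} (h1 : p ≤ 1)
    (hp : 1 / 2 - 1 / √(2 ^ n) ≤ p) :
    (n : ℝ) - 2 ≤ 2 * p * Real.logb 2 ((2 : ℝ) ^ (n - 1) - 1) + 2 * binEnt p := by
  have hlog := sub_three_halves_le_logb hn
  have hn' : (3 : ℝ) ≤ n := by exact_mod_cast hn
  have hs := two_mul_add_one_le_sqrt_two_pow hn
  have hs0 : 0 < √((2 : ℝ) ^ n) := by positivity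
  have hs1 : (2 * (n : ℝ) + 1) * (1 / √(2 ^ n)) ≤ 5 / 2 := by
    rw [mul_one_div, div_le_iff₀ hs0]; linarith
  have h0 : 0 ≤ p := by nlinarith
  rcases le_total p (1 / 2) with h | h
  · have := two_mul_le_binEnt h0 h
    nlinarith [mul_le_mul_of_nonneg_left hlog h0]
  · have := binEnt_nonneg h0 h1
    nlinarith [mul_le_mul_of_nonneg_left hlog h0]

open scoped MatrixOrder in
lemma Matrix.PosSemidef.exists_eq_conjTranspose_mul_self {ι : Type*} [Fintype ι] [DecidableEq ι]
    {A : Matrix ι ι ℂ} (hA : A.PosSemidef) : ∃ B : Matrix ι ι ℂ, A = Bᴴ * B :=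
  CStarAlgebra.nonneg_iff_eq_star_mul_self.mp hA.nonneg

theorem stmt4 (n : ℕ) (hn : 3 ≤ n)
    (ρ : Matrix (Fin n → Fin 2) (Fin n → Fin 2) ℂ)
    (hρ : ρ.PosSemidef) (htr : ρ.trace = 1)
    (Hd : Matrix (Fin n → Fin 2) (Fin n → Fin 2) ℂ)
    (hHd : ∀ a b, Hd a b = (-1 : ℂ) ^ (∑ i, (a i).val * (b i).val) / (Real.sqrt (2 ^ n) : ℝ))
    (pz px : ℝ)
    (hpz : pz = ∑ a ∈ Finset.univ.filter
        (fun a : Fin n → Fin 2 => 1 ≤ hammingWt a ∧ hammingWt a ≤ n - 1), (ρ a a).re)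
    (hpx : px = ∑ a ∈ Finset.univ.filter
        (fun a : Fin n → Fin 2 => 1 ≤ hammingWt a ∧ hammingWt a ≤ n - 1),
          ((Hd * ρ * Hd) a a).re) :
    2 * ((pz + px) / 2) * Real.logb 2 ((2 : ℝ) ^ (n - 1) - 1)
        + 2 * binEnt ((pz + px) / 2) ≥ (n : ℝ) - 2 := by
  have hs0 : 0 < √((2 : ℝ) ^ n) := by positivity
  have hnorm : ∀ a b, ‖Hd a b‖ ≤ 1 / √(2 ^ n) := by
    intro a b
    rw [hHd, norm_div, norm_pow, norm_neg, norm_one, one_pow, Complex.norm_real,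
      Real.norm_of_nonneg hs0.le]
  have hherm : Hdᴴ = Hd := by
    ext a b
    rw [conjTranspose_apply, hHd, hHd]
    simp [mul_comm]
  have hsq : Hd * Hd = 1 := by
    ext a c
    have h := sum_neg_one_pow_dot_mul a c
    have hss : ((√(2 ^ n) : ℝ) : ℂ) * ((√(2 ^ n) : ℝ) : ℂ) = 2 ^ n := by
      rw [← Complex.ofReal_mul, Real.mul_self_sqrt (by positivity)]
      push_cast; rfl
    simp only [mul_apply, hHd, div_mul_div_comm, hss, one_apply]
    rw [← Finset.sum_div, h]
    split_ifs <;> simp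
  obtain ⟨B, rfl⟩ : ∃ B : Matrix (Fin n → Fin 2) (Fin n → Fin 2) ℂ, ρ = Bᴴ * B :=
    hρ.exists_eq_conjTranspose_mul_self
  have hdiag : ∀ (C : Matrix (Fin n → Fin 2) (Fin n → Fin 2) ℂ) a,
      ((Cᴴ * C) a a).re = ∑ k, ‖C k a‖ ^ 2 := by
    intro C a
    rw [mul_apply, Complex.re_sum]
    refine Finset.sum_congr rfl fun k _ => ?_
    rw [conjTranspose_apply, ← starRingEnd_apply, ← Complex.normSq_eq_conj_mul_self,
      Complex.ofReal_re, Complex.normSq_eq_norm_sq]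
  have hconj : Hd * (Bᴴ * B) * Hd = (B * Hd)ᴴ * (B * Hd) := by
    rw [conjTranspose_mul, hherm]
    simp only [Matrix.mul_assoc]
  have htr' : (Hd * (Bᴴ * B) * Hd).trace = 1 := by
    rw [trace_mul_comm, ← Matrix.mul_assoc, hsq, Matrix.one_mul, htr]
  rw [hconj] at htr' hpx
  have htot : ∀ C : Matrix (Fin n → Fin 2) (Fin n → Fin 2) ℂ, (Cᴴ * C).trace = 1 →
      ∑ a, ∑ k, ‖C k a‖ ^ 2 = 1 := by
    intro C hC
    have := congrArg Complex.re hC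
    simpa [trace, diag_apply, Complex.re_sum, hdiag] using this
  have hz := htot B htr
  have hx := htot (B * Hd) htr'
  simp only [hdiag] at hpz hpx
  set Q : (Fin n → Fin 2) → Prop := fun a => 1 ≤ hammingWt a ∧ hammingWt a ≤ n - 1
  have hz' := Finset.sum_filter_add_sum_filter_not univ Q fun a => ∑ k, ‖B k a‖ ^ 2
  have hx' := Finset.sum_filter_add_sum_filter_not univ Q fun a => ∑ k, ‖(B * Hd) k a‖ ^ 2
  rw [hz, ← hpz] at hz'
  rw [hx, ← hpx] at hx'
  set S : Finset (Fin n → Fin 2) := {a | ¬ Q a}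
  have hcard : (#S : ℝ) ≤ 2 := by exact_mod_cast card_filter_not_hammingWt_le_two n
  have hzS : 0 ≤ ∑ a ∈ S, ∑ k, ‖B k a‖ ^ 2 := by positivity
  have hxS : 0 ≤ ∑ a ∈ S, ∑ k, ‖(B * Hd) k a‖ ^ 2 := by positivity
  have hbound : ∑ a ∈ S, ∑ k, ‖B k a‖ ^ 2 + ∑ a ∈ S, ∑ k, ‖(B * Hd) k a‖ ^ 2
      ≤ 1 + 2 * (1 / √(2 ^ n)) := by
    have hrow := Finset.sum_le_sum fun k (_ : k ∈ univ) =>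
      sum_norm_sq_add_sum_norm_sq_vecMul_le Hd (by rw [hherm, hsq]) _ (by positivity) hnorm S (B k)
    rw [Finset.sum_add_distrib, ← Finset.mul_sum, Finset.sum_comm,
      Finset.sum_comm (t := S), Finset.sum_comm (s := univ) (t := univ), hz, mul_one] at hrow
    refine hrow.trans ?_
    gcongr
  exact sub_two_le_of_half_sub_le hn (by linarith) (by linarith)
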